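/- The map p: E_n → B_n is a fiber bundle with fiber the n-dimensional torus: for every point b₀ ∈ B_n there exist an open neighborhood 𝒪 of b₀ in B_n and a homeomorphism φ: p⁻¹(𝒪) → 𝒪 × (S¹)ⁿ such that the composition of φ with the projection 𝒪 × (S¹)ⁿ → 𝒪 equals the restriction of p to p⁻¹(𝒪). -/

import Mathlib

noncomputable section

abbrev Mat (n : ℕ) : Type := Matrix (Fin n) (Fin n) ℂ

/-- Operator norm on matrices induced by the Euclidean norm on `ℂⁿ`. -/
noncomputable def opNorm {n : ℕ} (A : Mat n) : ℝ :=
  ‖(Matrix.toEuclideanCLM (𝕜 := ℂ) (n := Fin n)) A‖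

/-- An orthogonal decomposition of `ℂⁿ`: a set of `n` pairwise orthogonal rank-one
orthogonal projections summing to the identity. -/
structure OrthDecomp (n : ℕ) where
  carrier : Finset (Mat n)
  card_eq : carrier.card = n
  herm : ∀ P ∈ carrier, P.conjTranspose = P
  idem : ∀ P ∈ carrier, P * P = P
  rank_one : ∀ P ∈ carrier, P.rank = 1
  orth : ∀ P ∈ carrier, ∀ Q ∈ carrier, P ≠ Q → P * Q = 0
  sum_eq : (∑ P ∈ carrier, P) = 1

/-- The space `B_n` of triples `(𝒫, 𝒬, σ)`. -/
structure Bn (n : ℕ) where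
  decA : OrthDecomp n
  decB : OrthDecomp n
  bij : {M // M ∈ decA.carrier} ≃ {M // M ∈ decB.carrier}

/-- The quantity `max_{P ∈ 𝒫} max(‖P − τ(P)‖, ‖σ(P) − σ̃(τ(P))‖)` for a bijection `τ`. -/
noncomputable def tripVal {n : ℕ} (a b : Bn n)
    (τ : {M // M ∈ a.decA.carrier} ≃ {M // M ∈ b.decA.carrier}) : ℝ :=
  ⨆ P : {M // M ∈ a.decA.carrier},
    max (opNorm ((P : Mat n) - (τ P : Mat n)))
        (opNorm ((a.bij P : Mat n) - (b.bij (τ P) : Mat n)))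

/-- The distance function `d` on `B_n`. -/
noncomputable def Bdist {n : ℕ} (a b : Bn n) : ℝ :=
  ⨅ τ : {M // M ∈ a.decA.carrier} ≃ {M // M ∈ b.decA.carrier}, tripVal a b τ

/-- `U` is a unitary matrix. -/
def IsUnitary {n : ℕ} (U : Mat n) : Prop :=
  U * U.conjTranspose = 1 ∧ U.conjTranspose * U = 1

/-- Membership of `((𝒫,𝒬,σ), U)` in `E_n`: `U` is unitary and `U P U* = σ(P)`
for all `P ∈ 𝒫`. -/
def EnMem {n : ℕ} (a : Bn n) (U : Mat n) : Prop :=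
  IsUnitary U ∧ ∀ P : {M // M ∈ a.decA.carrier},
    U * (P : Mat n) * U.conjTranspose = (a.bij P : Mat n)

/-- The metric topology on `B_n` generated by the balls of the distance `Bdist`. -/
noncomputable instance Bn.instTopologicalSpace {n : ℕ} : TopologicalSpace (Bn n) :=
  TopologicalSpace.generateFrom {s | ∃ (a : Bn n) (r : ℝ), s = {b | Bdist a b < r}}

/-- The total space `E_n ⊆ B_n × U_n`, with the subspace topology. -/
abbrev En (n : ℕ) : Type := {x : Bn n × Mat n // EnMem x.1 x.2}

/-- The projection `p : E_n → B_n`. -/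
def pEn {n : ℕ} (e : En n) : Bn n := e.1.1

section OperatorNorm

variable {n : ℕ}

lemma opNorm_zero : opNorm (0 : Mat n) = 0 := by simp [opNorm]

lemma opNorm_sub_comm (A B : Mat n) : opNorm (A - B) = opNorm (B - A) := by
  simp only [opNorm, map_sub]
  exact norm_sub_rev _ _

lemma opNorm_sub_le (A B C : Mat n) : opNorm (A - C) ≤ opNorm (A - B) + opNorm (B - C) := by
  simp only [opNorm, map_sub]
  exact norm_sub_le_norm_sub_add_norm_sub _ _ _

lemma opNorm_mul_le (A B : Mat n) : opNorm (A * B) ≤ opNorm A * opNorm B := by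
  simp only [opNorm, map_mul]
  exact norm_mul_le _ _

lemma opNorm_pos {A : Mat n} (hA : A ≠ 0) : 0 < opNorm A := by
  simpa [opNorm] using hA

/-- An idempotent annihilated by `B` has distance at least `1` from `B`. -/
lemma one_le_opNorm_sub {A B : Mat n} (hA : A * A = A) (h0 : A ≠ 0) (hBA : B * A = 0) :
    1 ≤ opNorm (A - B) := by
  have h := opNorm_mul_le (A - B) A
  rw [sub_mul, hA, hBA, sub_zero] at h
  have := opNorm_pos h0
  by_contra! hlt
  nlinarith

lemma continuous_of_opNorm {X : Type*} [TopologicalSpace X] {f : X → Mat n}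
    (hf : ∀ x, ∀ ε > 0, ∀ᶠ y in nhds x, opNorm (f y - f x) < ε) : Continuous f := by
  let L : (EuclideanSpace ℂ (Fin n) →L[ℂ] EuclideanSpace ℂ (Fin n)) →ₗ[ℂ] Mat n :=
    (Matrix.toEuclideanCLM (𝕜 := ℂ) (n := Fin n)).symm.toAlgEquiv.toLinearMap
  have hc : Continuous fun x => Matrix.toEuclideanCLM (𝕜 := ℂ) (n := Fin n) (f x) := by
    rw [continuous_iff_continuousAt]
    intro x
    rw [ContinuousAt, Metric.tendsto_nhds]
    intro ε hε
    filter_upwards [hf x ε hε] with y hy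
    rwa [dist_eq_norm, ← map_sub]
  have := (LinearMap.continuous_of_finiteDimensional L).comp hc
  convert this using 1
  ext1 x
  exact ((Matrix.toEuclideanCLM (𝕜 := ℂ) (n := Fin n)).symm_apply_apply (f x)).symm

end OperatorNorm

section RankOneProjections

open Matrix

variable {n : ℕ}

/-- A rank-one orthogonal projection. -/
structure IsRankOneProj (P : Mat n) : Prop where
  herm : P.conjTranspose = P
  idem : P * P = P
  rank_one : P.rank = 1

lemma IsRankOneProj.ne_zero {P : Mat n} (hP : IsRankOneProj P) : P ≠ 0 := by
  rintro rfl
  simpa using hP.rank_one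

lemma norm_toLp_sq (x : Fin n → ℂ) :
    ((‖WithLp.toLp 2 x‖ : ℝ) : ℂ) ^ 2 = star x ⬝ᵥ x := by
  have h := inner_self_eq_norm_sq_to_K (𝕜 := ℂ) (WithLp.toLp 2 x)
  rw [EuclideanSpace.inner_toLp_toLp, dotProduct_comm] at h
  exact h.symm

/-- The unit vector in the direction of `x`. -/
def unitVector (x : Fin n → ℂ) : Fin n → ℂ := ((‖WithLp.toLp 2 x‖ : ℝ) : ℂ)⁻¹ • x

lemma IsRankOneProj.vecMulVec_unitVector {P : Mat n} (hP : IsRankOneProj P) {x : Fin n → ℂ}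
    (hx : P *ᵥ x ≠ 0) : vecMulVec (unitVector (P *ᵥ x)) (star (unitVector (P *ᵥ x))) = P := by
  set y := P *ᵥ x with hy
  set N : ℂ := ((‖WithLp.toLp 2 y‖ : ℝ) : ℂ) with hN
  have hN0 : N ≠ 0 := by simpa [hN] using hx
  have hNs : star N = N := by simp [hN]
  have hPy : P *ᵥ y = y := by rw [hy, mulVec_mulVec, hP.idem]
  have hsq : N ^ 2 = star y ⬝ᵥ y := norm_toLp_sq y
  have hstar : star y ᵥ* P = star y := by
    have := star_mulVec P y
    rw [hPy, hP.herm] at this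
    exact this.symm
  have hspan : ∀ w, ∃ c : ℂ, c • y = P *ᵥ w := by
    have hfr : Module.finrank ℂ (LinearMap.range P.mulVecLin) = 1 := hP.rank_one
    intro w
    have := (finrank_eq_one_iff_of_nonzero' (K := ℂ)
      (⟨y, ⟨x, rfl⟩⟩ : LinearMap.range P.mulVecLin)
      (fun h => hx (congrArg Subtype.val h))).1 hfr ⟨P *ᵥ w, ⟨w, rfl⟩⟩
    obtain ⟨c, hc⟩ := this
    exact ⟨c, congrArg Subtype.val hc⟩
  refine ext_of_mulVec_single fun i => ?_
  set w : Fin n → ℂ := Pi.single i 1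
  obtain ⟨c, hc⟩ := hspan w
  have hcN : star y ⬝ᵥ w = c * N ^ 2 := by
    rw [hsq, ← smul_eq_mul, ← dotProduct_smul, hc, dotProduct_mulVec, hstar]
  rw [← hc, vecMulVec_mulVec]
  simp only [unitVector, star_smul, smul_dotProduct, hcN, ← hN]
  rw [star_inv₀, hNs]
  ext j
  simp
  field_simp

lemma IsRankOneProj.exists_eq_vecMulVec {P : Mat n} (hP : IsRankOneProj P) :
    ∃ x : Fin n → ℂ, vecMulVec x (star x) = P := by
  by_contra! h
  refine hP.ne_zero (ext_of_mulVec_single fun i => ?_)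
  by_contra h'
  exact h _ (hP.vecMulVec_unitVector (x := Pi.single i 1) (by rwa [zero_mulVec] at h'))

lemma IsRankOneProj.mulVec_ne_zero {P Q : Mat n} {x : Fin n → ℂ} (hP : IsRankOneProj P)
    (hx : vecMulVec x (star x) = P) (h : opNorm (P - Q) < 1) : Q *ᵥ x ≠ 0 := by
  intro h0
  refine h.not_ge (one_le_opNorm_sub hP.idem hP.ne_zero ?_)
  rw [← hx, mul_vecMulVec, h0, zero_vecMulVec]

lemma continuous_unitVector {X : Type*} [TopologicalSpace X] {f : X → Fin n → ℂ}
    (hf : Continuous f) (h0 : ∀ x, f x ≠ 0) : Continuous fun x => unitVector (f x) := by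
  unfold unitVector
  have hN : Continuous fun x => ((‖WithLp.toLp 2 (f x)‖ : ℝ) : ℂ) :=
    Complex.continuous_ofReal.comp ((PiLp.continuous_toLp 2 _).comp hf).norm
  exact (hN.inv₀ fun x => by simpa using h0 x).smul hf

lemma of_mul_single_mul (v : Fin n → Fin n → ℂ) (i : Fin n) :
    (Matrix.of v)ᵀ * single i i 1 * ((Matrix.of v)ᵀ)ᴴ = vecMulVec (v i) (star (v i)) := by
  ext a b
  simp [mul_apply, single_apply, vecMulVec_apply, Finset.sum_ite_eq, ite_and]

lemma of_mul_conjTranspose (v : Fin n → Fin n → ℂ) :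
    (Matrix.of v)ᵀ * ((Matrix.of v)ᵀ)ᴴ = ∑ i, vecMulVec (v i) (star (v i)) := by
  ext a b
  simp [mul_apply, vecMulVec_apply, Matrix.sum_apply]

end RankOneProjections

section Distance

variable {n : ℕ}

lemma OrthDecomp.isRankOneProj (D : OrthDecomp n) {P : Mat n} (hP : P ∈ D.carrier) :
    IsRankOneProj P :=
  ⟨D.herm P hP, D.idem P hP, D.rank_one P hP⟩

/-- Distinct members of an orthogonal decomposition have distance at least `1`. -/
lemma OrthDecomp.eq_of_opNorm_sub_lt (D : OrthDecomp n) {P Q : Mat n} (hP : P ∈ D.carrier)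
    (hQ : Q ∈ D.carrier) (h : opNorm (P - Q) < 1) : P = Q := by
  by_contra hne
  exact h.not_ge (one_le_opNorm_sub (D.idem P hP) (D.isRankOneProj hP).ne_zero
    (D.orth Q hQ P hP (Ne.symm hne)))

lemma opNorm_lt_of_tripVal_lt {a b : Bn n}
    {τ : {M // M ∈ a.decA.carrier} ≃ {M // M ∈ b.decA.carrier}} {r : ℝ} (h : tripVal a b τ < r)
    (P : {M // M ∈ a.decA.carrier}) :
    opNorm ((P : Mat n) - (τ P : Mat n)) < r ∧
      opNorm ((a.bij P : Mat n) - (b.bij (τ P) : Mat n)) < r :=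
  max_lt_iff.1 ((le_ciSup (f := fun P : {M // M ∈ a.decA.carrier} =>
    max (opNorm ((P : Mat n) - (τ P : Mat n)))
      (opNorm ((a.bij P : Mat n) - (b.bij (τ P) : Mat n))))
    (Set.finite_range _).bddAbove P).trans_lt h)

lemma exists_tripVal_lt {a b : Bn n} {r : ℝ} (h : Bdist a b < r) :
    ∃ τ : {M // M ∈ a.decA.carrier} ≃ {M // M ∈ b.decA.carrier}, tripVal a b τ < r := by
  have : Nonempty ({M // M ∈ a.decA.carrier} ≃ {M // M ∈ b.decA.carrier}) :=
    ⟨Finset.equivOfCardEq (a.decA.card_eq.trans b.decA.card_eq.symm)⟩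
  exact exists_lt_of_ciInf_lt h

lemma Bdist_self_lt (a : Bn n) {r : ℝ} (hr : 0 < r) : Bdist a a < r := by
  have h : tripVal a a (Equiv.refl _) = 0 := by
    simp [tripVal, opNorm_zero]
  refine lt_of_le_of_lt (ciInf_le (Set.finite_range _).bddBelow (Equiv.refl _)) ?_
  rwa [h]

lemma isOpen_ball (a : Bn n) (r : ℝ) : IsOpen {b | Bdist a b < r} :=
  TopologicalSpace.isOpen_generateFrom_of_mem ⟨a, r, rfl⟩

end Distance

section LocalFrames

open Matrix

variable {n : ℕ}

/-- Over a small ball around `a` the projections of a triple and their images can be matched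
with those of `a` so that they depend continuously on the triple. -/
lemma exists_continuous_matching (a : Bn n) :
    ∃ τ : ∀ b : {b // Bdist a b < 1 / 4},
        {M // M ∈ a.decA.carrier} ≃ {M // M ∈ b.1.decA.carrier},
      ∀ P : {M // M ∈ a.decA.carrier},
        (∀ b, opNorm ((P : Mat n) - (τ b P : Mat n)) < 1) ∧
        (∀ b : {b // Bdist a b < 1 / 4},
          opNorm ((a.bij P : Mat n) - (b.1.bij (τ b P) : Mat n)) < 1) ∧
        (Continuous fun b => (τ b P : Mat n)) ∧
        Continuous fun b : {b // Bdist a b < 1 / 4} => (b.1.bij (τ b P) : Mat n) := by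
  choose τ hτ using fun b : {b // Bdist a b < 1 / 4} => exists_tripVal_lt b.2
  have key : ∀ P, ∀ c : {b // Bdist a b < 1 / 4}, ∀ ε > 0, ∀ᶠ b in nhds c,
      opNorm ((τ b P : Mat n) - (τ c P : Mat n)) < ε ∧
        opNorm ((b.1.bij (τ b P) : Mat n) - (c.1.bij (τ c P) : Mat n)) < ε := by
    intro P c ε hε
    have hδ : 0 < min ε (1 / 4) := by positivity
    filter_upwards [((isOpen_ball c.1 (min ε (1 / 4))).preimage
      continuous_subtype_val).mem_nhds (Bdist_self_lt c.1 hδ)] with b hb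
    obtain ⟨ρ, hρ⟩ := exists_tripVal_lt hb
    have h := opNorm_lt_of_tripVal_lt hρ (τ c P)
    rw [lt_min_iff, lt_min_iff] at h
    have hPb := (opNorm_lt_of_tripVal_lt (hτ b) P).1
    have hPc := (opNorm_lt_of_tripVal_lt (hτ c) P).1
    have heq : ρ (τ c P) = τ b P := by
      refine Subtype.ext (b.1.decA.eq_of_opNorm_sub_lt (ρ (τ c P)).2 (τ b P).2 ?_)
      have h₁ := opNorm_sub_le (ρ (τ c P) : Mat n) (τ c P) (τ b P)
      have h₂ := opNorm_sub_le (τ c P : Mat n) P (τ b P)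
      rw [opNorm_sub_comm _ (τ c P : Mat n)] at h₁
      rw [opNorm_sub_comm _ (P : Mat n)] at h₂
      linarith [h.1.2]
    rw [heq] at h
    rw [opNorm_sub_comm, opNorm_sub_comm (b.1.bij (τ b P) : Mat n)]
    exact ⟨h.1.1, h.2.1⟩
  refine ⟨τ, fun P => ⟨fun b => ?_, fun b => ?_, ?_, ?_⟩⟩
  · linarith [(opNorm_lt_of_tripVal_lt (hτ b) P).1]
  · linarith [(opNorm_lt_of_tripVal_lt (hτ b) P).2]
  · exact continuous_of_opNorm fun c ε hε => (key P c ε hε).mono fun _ h => h.1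
  · exact continuous_of_opNorm fun c ε hε => (key P c ε hε).mono fun _ h => h.2

/-- A continuous family of rank-one projections close to a fixed one is spanned by a continuous
family of unit vectors. -/
lemma exists_continuous_vector {X : Type*} [TopologicalSpace X] {P : Mat n} {Q : X → Mat n}
    (hP : IsRankOneProj P) (hQ : ∀ x, IsRankOneProj (Q x)) (hPQ : ∀ x, opNorm (P - Q x) < 1)
    (hc : Continuous Q) :
    ∃ v : X → Fin n → ℂ, Continuous v ∧ ∀ x, vecMulVec (v x) (star (v x)) = Q x := by
  obtain ⟨y, hy⟩ := hP.exists_eq_vecMulVec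
  have h0 : ∀ x, Q x *ᵥ y ≠ 0 := fun x => hP.mulVec_ne_zero hy (hPQ x)
  exact ⟨fun x => unitVector (Q x *ᵥ y),
    continuous_unitVector (hc.matrix_mulVec continuous_const) h0,
    fun x => (hQ x).vecMulVec_unitVector (h0 x)⟩

lemma exists_continuous_frame {X : Type*} [TopologicalSpace X] {Q : X → Fin n → Mat n}
    (hsum : ∀ x, ∑ i, Q x i = 1)
    (h : ∀ i, ∃ v : X → Fin n → ℂ, Continuous v ∧ ∀ x, vecMulVec (v x) (star (v x)) = Q x i) :
    ∃ V : X → Mat n, Continuous V ∧ (∀ x, IsUnitary (V x)) ∧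
      ∀ x i, V x * single i i 1 * (V x)ᴴ = Q x i := by
  choose v hv hQ using h
  refine ⟨fun x => (Matrix.of fun i => v i x)ᵀ, ?_, fun x => ?_, fun x i => ?_⟩
  · exact continuous_matrix fun i j => (continuous_apply i).comp (hv j)
  · have h1 : (Matrix.of fun i => v i x)ᵀ * ((Matrix.of fun i => v i x)ᵀ)ᴴ = 1 := by
      rw [of_mul_conjTranspose, ← hsum x]
      exact Finset.sum_congr rfl fun i _ => hQ i x
    exact ⟨h1, mul_eq_one_comm.1 h1⟩
  · rw [of_mul_single_mul]
    exact hQ i x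

lemma OrthDecomp.sum_equiv (D : OrthDecomp n) (e : Fin n ≃ {M // M ∈ D.carrier}) :
    ∑ i, (e i : Mat n) = 1 := by
  rw [← D.sum_eq, e.sum_comp (fun M : {M // M ∈ D.carrier} => (M : Mat n))]
  exact Finset.sum_coe_sort D.carrier fun M => M

/-- Over a small ball, both decompositions are diagonalized by continuous unitary frames, in an
order compatible with the bijections. -/
lemma exists_local_frames (a : Bn n) :
    ∃ V W : {b // Bdist a b < 1 / 4} → Mat n, Continuous V ∧ Continuous W ∧
      (∀ b, IsUnitary (V b)) ∧ (∀ b, IsUnitary (W b)) ∧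
      ∀ b U, EnMem b.1 U ↔ IsUnitary U ∧ ∀ i,
        U * (V b * single i i 1 * (V b)ᴴ) * Uᴴ = W b * single i i 1 * (W b)ᴴ := by
  obtain ⟨τ, hτ⟩ := exists_continuous_matching a
  let e : Fin n ≃ {M // M ∈ a.decA.carrier} :=
    (Finset.equivFinOfCardEq a.decA.card_eq).symm
  obtain ⟨V, hVc, hVu, hV⟩ := exists_continuous_frame
    (Q := fun (b : {b // Bdist a b < 1 / 4}) i => (τ b (e i) : Mat n))
    (fun b => b.1.decA.sum_equiv (e.trans (τ b)))
    fun i => exists_continuous_vector (a.decA.isRankOneProj (e i).2)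
      (fun b => b.1.decA.isRankOneProj (τ b (e i)).2) (hτ (e i)).1 (hτ (e i)).2.2.1
  obtain ⟨W, hWc, hWu, hW⟩ := exists_continuous_frame
    (Q := fun (b : {b // Bdist a b < 1 / 4}) i => (b.1.bij (τ b (e i)) : Mat n))
    (fun b => b.1.decB.sum_equiv ((e.trans (τ b)).trans b.1.bij))
    fun i => exists_continuous_vector (a.decB.isRankOneProj (a.bij (e i)).2)
      (fun b => b.1.decB.isRankOneProj (b.1.bij (τ b (e i))).2) (hτ (e i)).2.1 (hτ (e i)).2.2.2
  refine ⟨V, W, hVc, hWc, hVu, hWu, fun b U => and_congr_right fun _ => ?_⟩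
  simp only [hV, hW]
  exact ⟨fun h i => h _, fun h P => by simpa using h ((e.trans (τ b)).symm P)⟩

lemma IsUnitary.mul {A B : Mat n} (hA : IsUnitary A) (hB : IsUnitary B) : IsUnitary (A * B) := by
  have h : (A * B) * (A * B)ᴴ = 1 := by
    rw [conjTranspose_mul, mul_assoc, ← mul_assoc B, hB.1, one_mul, hA.1]
  exact ⟨h, mul_eq_one_comm.1 h⟩

lemma IsUnitary.conjTranspose {A : Mat n} (hA : IsUnitary A) : IsUnitary Aᴴ :=
  ⟨by rw [conjTranspose_conjTranspose]; exact hA.2, by rw [conjTranspose_conjTranspose]; exact hA.1⟩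

lemma isUnitary_diagonal {z : Fin n → ℂ} (hz : ∀ i, ‖z i‖ = 1) : IsUnitary (diagonal z) := by
  have h : diagonal z * (diagonal z)ᴴ = 1 := by
    rw [diagonal_conjTranspose, diagonal_mul_diagonal, ← diagonal_one]
    congr 1
    ext i
    simp [Complex.mul_conj, Complex.normSq_eq_norm_sq, hz]
  exact ⟨h, mul_eq_one_comm.1 h⟩

lemma IsUnitary.norm_diag_eq_one {z : Fin n → ℂ} (hz : IsUnitary (diagonal z)) (i : Fin n) :
    ‖z i‖ = 1 := by
  have h := congrFun (congrFun hz.1 i) i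
  rw [diagonal_conjTranspose, diagonal_mul_diagonal, diagonal_apply_eq, one_apply_eq] at h
  simp only [Pi.star_apply, RCLike.star_def, Complex.mul_conj, Complex.normSq_eq_norm_sq] at h
  have h' : ‖z i‖ ^ 2 = 1 := by exact_mod_cast h
  nlinarith [norm_nonneg (z i)]

lemma diagonal_diag_of_conj_single {D : Mat n} (hD : IsUnitary D)
    (h : ∀ i, D * single i i 1 * Dᴴ = single i i 1) : diagonal D.diag = D := by
  ext i j
  by_cases hij : i = j
  · subst hij; simp
  · have hc : D * single j j 1 = single j j 1 * D := by
      rw [← h j, mul_assoc _ Dᴴ D, hD.2, mul_one, h j]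
    have := congrFun (congrFun hc i) j
    simp [mul_apply, single_apply, Ne.symm hij] at this
    simp [hij, this]

/-- Unitaries that map one frame of projections to another are diagonal in these frames. -/
lemma conj_frames_iff {U V W : Mat n} (hV : IsUnitary V) (hW : IsUnitary W) :
    (IsUnitary U ∧ ∀ i, U * (V * single i i 1 * Vᴴ) * Uᴴ = W * single i i 1 * Wᴴ) ↔
      ∃ z : Fin n → ℂ, (∀ i, ‖z i‖ = 1) ∧ U = W * diagonal z * Vᴴ := by
  constructor
  · rintro ⟨hU, h⟩
    have hD : IsUnitary (Wᴴ * U * V) := (hW.conjTranspose.mul hU).mul hV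
    have hdiag : diagonal (Wᴴ * U * V).diag = Wᴴ * U * V := by
      refine diagonal_diag_of_conj_single hD fun i => ?_
      calc Wᴴ * U * V * single i i 1 * (Wᴴ * U * V)ᴴ
          = Wᴴ * (U * (V * single i i 1 * Vᴴ) * Uᴴ) * W := by
            simp [conjTranspose_mul, mul_assoc]
        _ = (Wᴴ * W) * single i i 1 * (Wᴴ * W) := by rw [h i]; simp only [mul_assoc]
        _ = single i i 1 := by rw [hW.2, one_mul, mul_one]
    refine ⟨(Wᴴ * U * V).diag, (hdiag.symm ▸ hD).norm_diag_eq_one, ?_⟩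
    calc U = (W * Wᴴ) * U * (V * Vᴴ) := by rw [hW.1, hV.1, one_mul, mul_one]
      _ = W * (Wᴴ * U * V) * Vᴴ := by simp only [mul_assoc]
      _ = _ := by rw [hdiag]
  · rintro ⟨z, hz, rfl⟩
    have hd := isUnitary_diagonal hz
    refine ⟨(hW.mul hd).mul hV.conjTranspose, fun i => ?_⟩
    have hs : diagonal z * single i i 1 * (diagonal z)ᴴ = single i i 1 := by
      have hc : diagonal z * single i i 1 = single i i 1 * diagonal z := by
        ext a b
        simp only [diagonal_mul, mul_diagonal, single_apply]
        split_ifs with hab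
        · rw [← hab.1, ← hab.2, mul_comm]
        · simp
      rw [hc, mul_assoc, hd.1, mul_one]
    calc W * diagonal z * Vᴴ * (V * single i i 1 * Vᴴ) * (W * diagonal z * Vᴴ)ᴴ
        = W * (diagonal z * (Vᴴ * V) * single i i 1 * (Vᴴ * V) * (diagonal z)ᴴ) * Wᴴ := by
          simp only [conjTranspose_mul, conjTranspose_conjTranspose, mul_assoc]
      _ = W * single i i 1 * Wᴴ := by rw [hV.2, mul_one, mul_one, hs]

end LocalFrames

/-- `p : E_n → B_n` is a fiber bundle with fiber the `n`-torus: every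
point of `B_n` has an open neighborhood `𝒪` and a homeomorphism
`φ : p⁻¹(𝒪) ≃ₜ 𝒪 × (S¹)ⁿ` commuting with the projections to `𝒪`. -/
theorem En_isFiberBundle {n : ℕ} (hn : 1 ≤ n) (b₀ : Bn n) :
    ∃ O : Set (Bn n), IsOpen O ∧ b₀ ∈ O ∧
      ∃ φ : {e : En n // pEn e ∈ O} ≃ₜ (↥O × (Fin n → ↥(Metric.sphere (0 : ℂ) 1))),
        ∀ e : {e : En n // pEn e ∈ O}, ((φ e).1 : Bn n) = pEn (e : En n) := by
  open Matrix in
  obtain ⟨V, W, hVc, hWc, hV, hW, hE⟩ := exists_local_frames b₀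
  have hiff : ∀ (b : {b // Bdist b₀ b < 1 / 4}) (U : Mat n), EnMem b.1 U ↔
      ∃ z : Fin n → ℂ, (∀ i, ‖z i‖ = 1) ∧ U = W b * diagonal z * (V b)ᴴ := fun b U =>
    (hE b U).trans (conj_frames_iff (hV b) (hW b))
  have hcoord : ∀ b (z : Fin n → ℂ),
      ((W b)ᴴ * (W b * diagonal z * (V b)ᴴ) * V b).diag = z := fun b z => by
    have : (W b)ᴴ * (W b * diagonal z * (V b)ᴴ) * V b
        = ((W b)ᴴ * W b) * diagonal z * ((V b)ᴴ * V b) := by simp only [mul_assoc]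
    rw [this, (hW b).2, (hV b).2, one_mul, mul_one, diag_diagonal]
  let O : Set (Bn n) := {b | Bdist b₀ b < 1 / 4}
  let base : {e : En n // pEn e ∈ O} → {b // Bdist b₀ b < 1 / 4} := fun e => ⟨pEn e.1, e.2⟩
  have hbase : Continuous base :=
    Continuous.subtype_mk (continuous_fst.comp
      (continuous_subtype_val.comp continuous_subtype_val)) _
  let coord : {e : En n // pEn e ∈ O} → Fin n → ℂ := fun e =>
    ((W (base e))ᴴ * e.1.1.2 * V (base e)).diag
  have hcoordc : Continuous coord :=
    ((((hWc.comp hbase).matrix_conjTranspose).matrix_mul (continuous_snd.comp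
      (continuous_subtype_val.comp continuous_subtype_val))).matrix_mul
        (hVc.comp hbase)).matrix_diag
  have hnorm : ∀ e i, coord e i ∈ Metric.sphere (0 : ℂ) 1 := by
    intro e i
    obtain ⟨z, hz, hU⟩ := (hiff (base e) e.1.1.2).1 e.1.2
    have : coord e = z := by
      simp only [coord]
      rw [hU, hcoord]
    rw [this, mem_sphere_zero_iff_norm, hz]
  refine ⟨O, isOpen_ball b₀ _, Bdist_self_lt b₀ (by norm_num),
    { toFun := fun e => (base e, fun i => ⟨coord e i, hnorm e i⟩)
      invFun := fun x => ⟨⟨(x.1.1, W x.1 * diagonal (fun i => (x.2 i : ℂ)) * (V x.1)ᴴ),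
        (hiff x.1 _).2 ⟨_, fun i => mem_sphere_zero_iff_norm.1 (x.2 i).2, rfl⟩⟩, x.1.2⟩
      left_inv := ?_
      right_inv := ?_
      continuous_toFun := ?_
      continuous_invFun := ?_ }, fun e => rfl⟩
  · intro e
    refine Subtype.ext (Subtype.ext (Prod.ext rfl ?_))
    obtain ⟨z, hz, hU⟩ := (hiff (base e) e.1.1.2).1 e.1.2
    change W (base e) * diagonal (coord e) * (V (base e))ᴴ = e.1.1.2
    simp only [coord]
    rw [hU, hcoord]
  · intro x
    refine Prod.ext rfl (funext fun i => Subtype.ext ?_)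
    exact congrFun (hcoord x.1 fun i => (x.2 i : ℂ)) i
  · exact hbase.prodMk (continuous_pi fun i =>
      Continuous.subtype_mk ((continuous_apply i).comp hcoordc) _)
  · refine Continuous.subtype_mk (Continuous.subtype_mk
      ((continuous_subtype_val.comp continuous_fst).prodMk ?_) _) _
    refine (((hWc.comp continuous_fst).matrix_mul (Continuous.matrix_diagonal ?_))).matrix_mul
      (hVc.comp continuous_fst).matrix_conjTranspose
    exact continuous_pi fun i =>
      continuous_subtype_val.comp ((continuous_apply i).comp continuous_snd)
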